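/- In the asynchronous Sinkhorn algorithm there exists y* ∈ Y such that v^ℓ(y*) = v⁰(y*) for every iteration index ℓ ≥ 0. -/

import Mathlib

/-- One `u`-update of the Sinkhorn algorithm: `u(x) = μ(x) / Σ_y K(x,y) v(y)`. -/
noncomputable def uOf {X Y : Type*} [Fintype Y] (K : X → Y → ℝ) (μ : X → ℝ)
    (v : Y → ℝ) : X → ℝ :=
  fun x => μ x / ∑ y, K x y * v y

/-- One `v̂`-update of the Sinkhorn algorithm: `v̂(y) = ν(y) / Σ_x K(x,y) u(x)`. -/
noncomputable def vhatOf {X Y : Type*} [Fintype X] (K : X → Y → ℝ) (ν : Y → ℝ)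
    (u : X → ℝ) : Y → ℝ :=
  fun y => ν y / ∑ x, K x y * u x

/-- The `v`-iterates of the asynchronous Sinkhorn algorithm:
`v⁰ = v0`, `v^{ℓ+1}(y) = min (v^ℓ(y), v̂^{ℓ+1}(y))` with
`v̂^{ℓ+1} = vhatOf K ν (uOf K μ (v^ℓ))`. -/
noncomputable def sinkV {X Y : Type*} [Fintype X] [Fintype Y] (K : X → Y → ℝ)
    (μ : X → ℝ) (ν : Y → ℝ) (v0 : Y → ℝ) : ℕ → Y → ℝ
  | 0 => v0
  | ℓ + 1 => fun y =>
      min (sinkV K μ ν v0 ℓ y) (vhatOf K ν (uOf K μ (sinkV K μ ν v0 ℓ)) y)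

section AsyncSinkhorn

variable {X Y : Type*} {K : X → Y → ℝ} {μ : X → ℝ} {ν : Y → ℝ}

theorem sum_kernel_mul_pos {ι κ : Type*} [Fintype ι] [Nonempty ι] {L : κ → ι → ℝ}
    (hL : ∀ k i, 0 < L k i) {w : ι → ℝ} (hw : ∀ i, 0 < w i) (k : κ) :
    0 < ∑ i, L k i * w i :=
  Finset.sum_pos (fun i _ => mul_pos (hL k i) (hw i)) Finset.univ_nonempty

theorem uOf_pos [Fintype Y] [Nonempty Y] (hK : ∀ x y, 0 < K x y) (hμ : ∀ x, 0 < μ x) {v : Y → ℝ}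
    (hv : ∀ y, 0 < v y) (x : X) : 0 < uOf K μ v x :=
  div_pos (hμ x) (sum_kernel_mul_pos hK hv x)

theorem vhatOf_pos [Fintype X] [Nonempty X] (hK : ∀ x y, 0 < K x y) (hν : ∀ y, 0 < ν y) {u : X → ℝ}
    (hu : ∀ x, 0 < u x) (y : Y) : 0 < vhatOf K ν u y :=
  div_pos (hν y) (sum_kernel_mul_pos (L := fun y x => K x y) (fun y x => hK x y) hu y)

theorem uOf_anti [Fintype Y] [Nonempty Y] (hK : ∀ x y, 0 < K x y) (hμ : ∀ x, 0 < μ x) {v w : Y → ℝ}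
    (hv : ∀ y, 0 < v y) (hvw : ∀ y, v y ≤ w y) (x : X) : uOf K μ w x ≤ uOf K μ v x :=
  div_le_div_of_nonneg_left (hμ x).le (sum_kernel_mul_pos hK hv x)
    (Finset.sum_le_sum fun y _ => mul_le_mul_of_nonneg_left (hvw y) (hK x y).le)

theorem vhatOf_anti [Fintype X] [Nonempty X] (hK : ∀ x y, 0 < K x y) (hν : ∀ y, 0 < ν y)
    {u w : X → ℝ}
    (hu : ∀ x, 0 < u x) (huw : ∀ x, u x ≤ w x) (y : Y) : vhatOf K ν w y ≤ vhatOf K ν u y :=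
  div_le_div_of_nonneg_left (hν y).le
    (sum_kernel_mul_pos (L := fun y x => K x y) (fun y x => hK x y) hu y)
    (Finset.sum_le_sum fun x _ => mul_le_mul_of_nonneg_left (huw x) (hK x y).le)

variable [Fintype X] [Fintype Y]

/-- After a `u`-update the column marginals have total mass `∑ x, μ x`. -/
theorem sum_column_marginal_uOf [Nonempty Y] (hK : ∀ x y, 0 < K x y) {v : Y → ℝ}
    (hv : ∀ y, 0 < v y) : ∑ y, v y * ∑ x, K x y * uOf K μ v x = ∑ x, μ x := by
  simp_rw [Finset.mul_sum]
  rw [Finset.sum_comm]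
  refine Finset.sum_congr rfl fun x _ => ?_
  have hne := (sum_kernel_mul_pos hK hv x).ne'
  calc ∑ y, v y * (K x y * uOf K μ v x) = (∑ y, K x y * v y) * uOf K μ v x := by
        rw [Finset.sum_mul]
        exact Finset.sum_congr rfl fun y _ => by ring
    _ = μ x := mul_div_cancel₀ _ hne

/-- If a full Sinkhorn update increases no component, it leaves every component fixed. -/
theorem le_vhatOf_of_forall_vhatOf_le [Nonempty X] [Nonempty Y] (hK : ∀ x y, 0 < K x y)
    (hμ : ∀ x, 0 < μ x) (hmass : ∑ x, μ x = ∑ y, ν y) {v : Y → ℝ} (hv : ∀ y, 0 < v y)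
    (h : ∀ y, vhatOf K ν (uOf K μ v) y ≤ v y) (y : Y) :
    v y ≤ vhatOf K ν (uOf K μ v) y := by
  have hS := sum_kernel_mul_pos (L := fun y x => K x y) (fun y x => hK x y)
    (uOf_pos hK hμ hv)
  by_contra! hlt
  have hsum : ∑ y, ν y < ∑ y, v y * ∑ x, K x y * uOf K μ v x :=
    Finset.sum_lt_sum (fun z _ => (div_le_iff₀ (hS z)).1 (h z))
      ⟨y, Finset.mem_univ y, (div_lt_iff₀ (hS y)).1 hlt⟩
  rw [sum_column_marginal_uOf hK hv, hmass] at hsum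
  exact hsum.false

variable {v0 : Y → ℝ}

theorem sinkV_pos [Nonempty X] [Nonempty Y] (hK : ∀ x y, 0 < K x y) (hμ : ∀ x, 0 < μ x)
    (hν : ∀ y, 0 < ν y) (hv0 : ∀ y, 0 < v0 y) (n : ℕ) : ∀ y, 0 < sinkV K μ ν v0 n y := by
  induction n with
  | zero => exact hv0
  | succ n ih => exact fun y => lt_min (ih y) (vhatOf_pos hK hν (uOf_pos hK hμ ih) y)

theorem sinkV_antitone : Antitone (sinkV K μ ν v0) :=
  antitone_nat_of_succ_le fun _ _ => min_le_left _ _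

/-- A component that has left its initial value is never increased by a full update. -/
theorem sinkV_eq_or_vhatOf_le [Nonempty X] [Nonempty Y] (hK : ∀ x y, 0 < K x y)
    (hμ : ∀ x, 0 < μ x) (hν : ∀ y, 0 < ν y) (hv0 : ∀ y, 0 < v0 y) (n : ℕ) (y : Y) :
    sinkV K μ ν v0 n y = v0 y ∨
      vhatOf K ν (uOf K μ (sinkV K μ ν v0 n)) y ≤ sinkV K μ ν v0 n y := by
  induction n with
  | zero => exact Or.inl rfl
  | succ n ih =>
    have hpos := sinkV_pos hK hμ hν hv0
    have hanti : vhatOf K ν (uOf K μ (sinkV K μ ν v0 (n + 1))) y ≤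
        vhatOf K ν (uOf K μ (sinkV K μ ν v0 n)) y :=
      vhatOf_anti hK hν (uOf_pos hK hμ (hpos n))
        (uOf_anti hK hμ (hpos (n + 1)) (sinkV_antitone n.le_succ)) y
    have hstep : sinkV K μ ν v0 (n + 1) y =
        min (sinkV K μ ν v0 n y) (vhatOf K ν (uOf K μ (sinkV K μ ν v0 n)) y) := rfl
    rcases le_total (vhatOf K ν (uOf K μ (sinkV K μ ν v0 n)) y) (sinkV K μ ν v0 n y)
      with hle | hle
    · exact Or.inr (hanti.trans_eq (hstep.trans (min_eq_right hle)).symm)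
    · rw [min_eq_left hle] at hstep
      rw [hstep]
      exact ih.imp_right hanti.trans

theorem exists_sinkV_eq [Nonempty X] [Nonempty Y] (hK : ∀ x y, 0 < K x y)
    (hμ : ∀ x, 0 < μ x) (hν : ∀ y, 0 < ν y) (hmass : ∑ x, μ x = ∑ y, ν y)
    (hv0 : ∀ y, 0 < v0 y) (n : ℕ) : ∃ y, sinkV K μ ν v0 n y = v0 y := by
  induction n with
  | zero => exact ⟨Classical.arbitrary Y, rfl⟩
  | succ n ih =>
    by_contra! hne
    obtain ⟨y, hy⟩ := ih
    have hle : ∀ z, vhatOf K ν (uOf K μ (sinkV K μ ν v0 n)) z ≤ sinkV K μ ν v0 n z := by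
      intro z
      rcases sinkV_eq_or_vhatOf_le hK hμ hν hv0 n z with hz | hz
      · by_contra! hlt
        exact hne z ((min_eq_left hlt.le).trans hz)
      · exact hz
    exact hne y ((min_eq_left (le_vhatOf_of_forall_vhatOf_le hK hμ hmass
      (sinkV_pos hK hμ hν hv0 n) hle y)).trans hy)

theorem exists_forall_sinkV_eq [Nonempty X] [Nonempty Y] (hK : ∀ x y, 0 < K x y)
    (hμ : ∀ x, 0 < μ x) (hν : ∀ y, 0 < ν y) (hmass : ∑ x, μ x = ∑ y, ν y)
    (hv0 : ∀ y, 0 < v0 y) : ∃ y, ∀ n, sinkV K μ ν v0 n y = v0 y := by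
  by_contra! h
  choose N hN using h
  obtain ⟨y, hy⟩ := exists_sinkV_eq hK hμ hν hmass hv0 (Finset.univ.sup N)
  refine hN y (le_antisymm (sinkV_antitone (Nat.zero_le (N y)) y) ?_)
  rw [← hy]
  exact sinkV_antitone (Finset.le_sup (Finset.mem_univ y)) y

end AsyncSinkhorn

theorem async_sinkhorn_fixed_component
    {X Y : Type*} [Fintype X] [Fintype Y] [Nonempty X] [Nonempty Y]
    (μ : X → ℝ) (ν : Y → ℝ) (hμ : ∀ x, 0 < μ x) (hν : ∀ y, 0 < ν y)
    (hμ1 : ∑ x, μ x = 1) (hν1 : ∑ y, ν y = 1)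
    (C : ℝ) (hC : 0 ≤ C) (c : X → Y → ℝ) (hc : ∀ x y, 0 ≤ c x y ∧ c x y ≤ C)
    (ε : ℝ) (hε : 0 < ε)
    (K : X → Y → ℝ) (hK : ∀ x y, K x y = Real.exp (-(c x y) / ε) * μ x * ν y)
    (v0 : Y → ℝ) (hv0 : ∀ y, 0 < v0 y)
    (v : ℕ → Y → ℝ) (hv : ∀ ℓ, v ℓ = sinkV K μ ν v0 ℓ)
    (u : ℕ → X → ℝ) (hu : ∀ ℓ, u ℓ = uOf K μ (v (ℓ - 1)))
    (vhat : ℕ → Y → ℝ) (hvhat : ∀ ℓ, vhat ℓ = vhatOf K ν (u ℓ))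
    (π : ℕ → X → Y → ℝ) (hπ : ∀ ℓ x y, π ℓ x y = u ℓ x * K x y * v ℓ y)
    (q : ℕ → ℝ) (hq : ∀ ℓ, q ℓ = ∑ x, ∑ y, π ℓ x y)
    (α : ℕ → X → ℝ) (hα : ∀ ℓ x, α ℓ x = ε * Real.log (u ℓ x)) :
    ∃ ys : Y, ∀ ℓ : ℕ, v ℓ ys = v0 ys := by
  have hKpos : ∀ x y, 0 < K x y := fun x y => by
    rw [hK]
    exact mul_pos (mul_pos (Real.exp_pos _) (hμ x)) (hν y)
  obtain ⟨y, hy⟩ := exists_forall_sinkV_eq hKpos hμ hν (hμ1.trans hν1.symm) hv0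
  exact ⟨y, fun n => by rw [hv, hy]⟩
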